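/- Let k, ℓ be integers with k ≥ 1 and 0 ≤ ℓ ≤ 2k−1, Γ a group, and α: 2^Γ → {0,1,…,ℓ} a normalized polymatroidal function satisfying the smoothness condition. Suppose the Γ-labeled graph (G,ψ) is near-balanced and f_α-full with β(E(G)) ≥ 2k−ℓ+1, and let v be a base for the near-balancedness. Then each fraction of v is near-balanced; in particular, for each extra edge set K of the near-balancedness, G − K is connected. -/

import Mathlib

/- Formalization of count matroids of group-labeled graphs. -/

namespace CountMatroidPaper

attribute [local instance] Classical.propDecidable

/-- A `Γ`-labeled graph: a directed multigraph with edge set `E`, vertex set `V`,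
and a gain (group label) on each edge. -/
structure GainGraph (V E Γ : Type*) where
  tail : E → V
  head : E → V
  gain : E → Γ

variable {V E Γ : Type*}

namespace GainGraph

variable [Group Γ]

/-- `V(F)`: the set of vertices incident to the edge set `F`. -/
def verts [DecidableEq V] (G : GainGraph V E Γ) (F : Finset E) : Finset V :=
  F.image G.tail ∪ F.image G.head

/-- `G.GainWalk F u w g` : there is a walk from `u` to `w` using edges of `F` whose gain is `g`. -/
inductive GainWalk (G : GainGraph V E Γ) (F : Set E) (u : V) : V → Γ → Prop
  | nil : GainWalk G F u u 1
  | fwd {w : V} {g : Γ} {e : E} : GainWalk G F u w g → e ∈ F → G.tail e = w →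
      GainWalk G F u (G.head e) (g * G.gain e)
  | bwd {w : V} {g : Γ} {e : E} : GainWalk G F u w g → e ∈ F → G.head e = w →
      GainWalk G F u (G.tail e) (g * (G.gain e)⁻¹)

/-- An edge set is balanced if every closed walk in it has identity gain. -/
def Balanced (G : GainGraph V E Γ) (F : Set E) : Prop :=
  ∀ (v : V) (g : Γ), G.GainWalk F v v g → g = 1

/-- Membership in `C(G)` : a nonempty edge set `F` such that `(V(F), F)` is connected. -/
def Connected [DecidableEq V] (G : GainGraph V E Γ) (F : Finset E) : Prop :=
  F.Nonempty ∧ ∀ u ∈ G.verts F, ∀ w ∈ G.verts F, ∃ g : Γ, G.GainWalk (↑F) u w g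

/-- The set of gains of closed walks based at `v` using edges of `F`. -/
def gains (G : GainGraph V E Γ) (F : Set E) (v : V) : Set Γ :=
  {g | G.GainWalk F v v g}

/-- `α̃(F)`: the value of `α` on (a generating set of) the subgroup `⟨F⟩_{v,ψ}` for a
vertex `v ∈ V(F)`.  For a polymatroidal `α` (invariant under conjugation and under taking
generated subgroups) this is independent of the choice of `v`. -/
noncomputable def alphaTilde (α : Set Γ → ℤ) (G : GainGraph V E Γ) (F : Finset E) : ℤ :=
  if h : F.Nonempty then α (G.gains (↑F) (G.tail h.choose)) else 0

/-- Loops at `v`. -/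
def loopsAt (G : GainGraph V E Γ) (v : V) : Set E :=
  {e | G.tail e = v ∧ G.head e = v}

/-- Unbalanced (non-identity labeled) loops at `v`, i.e. `L_v \ L_v°`. -/
def unbalancedLoopsAt (G : GainGraph V E Γ) (v : V) : Set E :=
  {e | G.tail e = v ∧ G.head e = v ∧ G.gain e ≠ 1}

/-- `E_v`: edges incident to `v`. -/
def incidentAt (G : GainGraph V E Γ) (v : V) : Set E :=
  {e | G.tail e = v ∨ G.head e = v}

/-- Non-loop edges incident to `v`. -/
def nonloopAt (G : GainGraph V E Γ) (v : V) : Set E :=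
  {e | (G.tail e = v ∨ G.head e = v) ∧ G.tail e ≠ G.head e}

/-- The split of `(G,ψ)` at `v` with respect to the bipartition `{E₁, E₂}` of the non-loop
edges incident to `v`, where `B = E₂`: the vertex `v` is split into `v₁ = Sum.inl v` and
`v₂ = Sum.inr ()`; edges in `B` become incident to `v₂`, the remaining non-loop edges at `v`
to `v₁`; balanced loops at `v` stay loops at `v₁`, and unbalanced loops at `v` become arcs
from `v₁` to `v₂`, keeping the labeling. -/
noncomputable def split (G : GainGraph V E Γ) (v : V) (B : Set E) :
    GainGraph (V ⊕ Unit) E Γ where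
  tail e :=
    if G.tail e = v ∧ G.head e = v then Sum.inl v
    else if G.tail e = v ∧ e ∈ B then Sum.inr ()
    else Sum.inl (G.tail e)
  head e :=
    if G.tail e = v ∧ G.head e = v then
      (if G.gain e = 1 then Sum.inl v else Sum.inr ())
    else if G.head e = v ∧ e ∈ B then Sum.inr ()
    else Sum.inl (G.head e)
  gain := G.gain

/-- `v` is a base for the near-balancedness of `F`, witnessed by the part `B` of the
bipartition of the non-loop edges at `v`: the corresponding split makes `F` balanced. -/
def IsSplitBase (G : GainGraph V E Γ) (F : Finset E) (v : V) (B : Set E) : Prop :=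
  B ⊆ G.nonloopAt v ∧ Balanced (G.split v B) (↑F)

/-- A connected edge set is near-balanced if it is unbalanced and some split of `(G,ψ)`
makes it balanced. -/
def NearBalanced (G : GainGraph V E Γ) (F : Finset E) : Prop :=
  ¬ G.Balanced (↑F) ∧ ∃ (v : V) (B : Set E), G.IsSplitBase F v B

/-- `K` is an extra edge set for the near-balancedness of `F` with base `v`:
`K = E₂ ∪ (L_v \ L_v°)` (or `E₁ ∪ (L_v \ L_v°)`) for a balanced split at `v` with
bipartition `{E₁, E₂}`. -/
def ExtraEdgeSet (G : GainGraph V E Γ) (F : Finset E) (v : V) (K : Set E) : Prop :=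
  ∃ B : Set E, G.IsSplitBase F v B ∧
    (K = B ∪ G.unbalancedLoopsAt v ∨
     K = (G.nonloopAt v \ B) ∪ G.unbalancedLoopsAt v)

/-- `β(F)`. -/
noncomputable def beta (α : Set Γ → ℤ) (k : ℤ) [DecidableEq V]
    (G : GainGraph V E Γ) (F : Finset E) : ℤ :=
  if G.NearBalanced F then min (alphaTilde α G F) k else alphaTilde α G F

/-- `f_α(F) = k|V(F)| - ℓ + β(F)`. -/
noncomputable def fAlpha (α : Set Γ → ℤ) (k ℓ : ℤ) [DecidableEq V]
    (G : GainGraph V E Γ) (F : Finset E) : ℤ :=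
  k * ((G.verts F).card : ℤ) - ℓ + beta α k G F

/-- `I` is `f_α`-sparse: `|F| ≤ f_α(F)` for every `F ∈ C(G)` with `F ⊆ I`. -/
def Sparse (α : Set Γ → ℤ) (k ℓ : ℤ) [DecidableEq V]
    (G : GainGraph V E Γ) (I : Finset E) : Prop :=
  ∀ F : Finset E, F ⊆ I → G.Connected F → (F.card : ℤ) ≤ fAlpha α k ℓ G F

/-- `F` is `f_α`-tight: connected, `f_α`-sparse, with `|F| = f_α(F)`. -/
def Tight (α : Set Γ → ℤ) (k ℓ : ℤ) [DecidableEq V]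
    (G : GainGraph V E Γ) (F : Finset E) : Prop :=
  G.Connected F ∧ Sparse α k ℓ G F ∧ (F.card : ℤ) = fAlpha α k ℓ G F

/-- An edge set `Y` is `f_α`-full: the subgraph `(V(Y), Y)` contains a spanning connected
`f_α`-sparse subgraph `G'` with `β(E(G')) = β(Y)` and
`|E(G')| ≥ k|V(G')| - ℓ + min{β(E(G')), 2k - ℓ + 1}`. -/
def Full (α : Set Γ → ℤ) (k ℓ : ℤ) [DecidableEq V]
    (G : GainGraph V E Γ) (Y : Finset E) : Prop :=
  ∃ E' : Finset E, E' ⊆ Y ∧ G.Connected E' ∧ G.verts E' = G.verts Y ∧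
    Sparse α k ℓ G E' ∧ beta α k G E' = beta α k G Y ∧
    k * ((G.verts E').card : ℤ) - ℓ + min (beta α k G E') (2 * k - ℓ + 1) ≤ (E'.card : ℤ)

/-- The graph `(G,ψ)` is `f_α`-full: it contains a spanning connected `f_α`-sparse
subgraph `G'` with `β(E(G')) = β(E(G))` and
`|E(G')| ≥ k|V(G')| - ℓ + min{β(E(G')), 2k - ℓ + 1}`. -/
def FullGraph [Fintype V] [Fintype E] [DecidableEq V]
    (α : Set Γ → ℤ) (k ℓ : ℤ) (G : GainGraph V E Γ) : Prop :=
  ∃ E' : Finset E, G.Connected E' ∧ G.verts E' = Finset.univ ∧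
    Sparse α k ℓ G E' ∧ beta α k G E' = beta α k G (Finset.univ : Finset E) ∧
    k * ((G.verts E').card : ℤ) - ℓ + min (beta α k G E') (2 * k - ℓ + 1) ≤ (E'.card : ℤ)

/-- `F` is `α`-critical: connected, near-balanced, and `α̃(F) > k`. -/
def AlphaCritical (α : Set Γ → ℤ) (k : ℤ) [DecidableEq V]
    (G : GainGraph V E Γ) (F : Finset E) : Prop :=
  G.Connected F ∧ G.NearBalanced F ∧ k < alphaTilde α G F

/-- Switching at `v` with `g`. -/
noncomputable def switch (G : GainGraph V E Γ) (v : V) (g : Γ) : GainGraph V E Γ where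
  tail := G.tail
  head := G.head
  gain e :=
    if G.tail e = v ∧ G.head e = v then g * G.gain e * g⁻¹
    else if G.tail e = v then g * G.gain e
    else if G.head e = v then G.gain e * g⁻¹
    else G.gain e

/-- Two gain functions (on the same underlying graph) are equivalent if one is obtained
from the other by a sequence of switchings. -/
def Equivalent (G G' : GainGraph V E Γ) : Prop :=
  Relation.ReflTransGen (fun H H' : GainGraph V E Γ => ∃ (v : V) (g : Γ), H' = H.switch v g) G G'

/-- The label of the edge `e`, re-oriented so that `e` is directed towards `v`. -/
noncomputable def orientTo (G : GainGraph V E Γ) (v : V) (e : E) : Γ :=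
  if G.head e = v then G.gain e else (G.gain e)⁻¹

/-- Adjacency in `G - v`. -/
def AdjAvoid (G : GainGraph V E Γ) (v u w : V) : Prop :=
  u ≠ v ∧ w ≠ v ∧ ∃ e : E, (G.tail e = u ∧ G.head e = w) ∨ (G.tail e = w ∧ G.head e = u)

/-- `S` is (the edge set of) a fraction of `v`: the subgraph of `G - L_v` induced by `v`
together with the vertex set of a connected component of `G - v`. -/
def IsFraction [Fintype E] (G : GainGraph V E Γ) (v : V) (S : Finset E) : Prop :=
  ∃ u : V, u ≠ v ∧
    S = Finset.univ.filter (fun e =>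
      ¬ (G.tail e = v ∧ G.head e = v) ∧
      (G.tail e = v ∨ Relation.ReflTransGen (G.AdjAvoid v) u (G.tail e)) ∧
      (G.head e = v ∨ Relation.ReflTransGen (G.AdjAvoid v) u (G.head e)))

/-- `I` is `(k,m)`-sparse: `|F| ≤ k|V(F)| - m` for every nonempty `F ⊆ I`. -/
def CountSparse [DecidableEq V] (G : GainGraph V E Γ) (k m : ℤ) (I : Finset E) : Prop :=
  ∀ F : Finset E, F ⊆ I → F.Nonempty → (F.card : ℤ) ≤ k * ((G.verts F).card : ℤ) - m

/-- `C` is a circuit of the `(k,m)`-count matroid `M_{k,m}(G)`: a minimal set that is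
not `(k,m)`-sparse. -/
def CountCircuit [DecidableEq V] (G : GainGraph V E Γ) (k m : ℤ) (C : Finset E) : Prop :=
  ¬ G.CountSparse k m C ∧ ∀ C' : Finset E, C' ⊆ C → C' ≠ C → G.CountSparse k m C'

end GainGraph

/-- `α : 2^Γ → ℤ` is polymatroidal. -/
structure Polymatroidal [Group Γ] (α : Set Γ → ℤ) : Prop where
  empty : α ∅ = 0
  submodular : ∀ X Y : Set Γ, α (X ∪ Y) + α (X ∩ Y) ≤ α X + α Y
  mono : ∀ X Y : Set Γ, X ⊆ Y → α X ≤ α Y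
  conj : ∀ (X : Set Γ) (γ : Γ), α ((fun x => γ * x * γ⁻¹) '' X) = α X
  clos : ∀ X : Set Γ, α ((Subgroup.closure X : Subgroup Γ) : Set Γ) = α X

/-- A polymatroidal function is normalized if `α({g}) ≠ 0` for every non-identity `g`
and `α({1}) = 0`. -/
def Normalized [Group Γ] (α : Set Γ → ℤ) : Prop :=
  (∀ g : Γ, g ≠ 1 → α {g} ≠ 0) ∧ α ({1} : Set Γ) = 0

/-- The smoothness condition: `α(S ∪ {g}) - α(S) > k` implies `S = {1}` and `g² ≠ 1`. -/
def Smooth [Group Γ] (α : Set Γ → ℤ) (k : ℤ) : Prop :=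
  ∀ (S : Set Γ) (g : Γ), S.Nonempty → k < α (S ∪ {g}) - α S →
    S = ({1} : Set Γ) ∧ g ^ 2 ≠ 1


namespace GainGraph

section

variable {V E Γ : Type*} {G : GainGraph V E Γ}

lemma mem_verts [DecidableEq V] {F : Finset E} {w : V} :
    w ∈ G.verts F ↔ ∃ e ∈ F, G.tail e = w ∨ G.head e = w := by
  simp only [verts, Finset.mem_union, Finset.mem_image]
  grind

lemma ne_of_reflTransGen_adjAvoid {v u w : V} (hu : u ≠ v)
    (h : Relation.ReflTransGen (G.AdjAvoid v) u w) : w ≠ v := by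
  rcases h.cases_tail with rfl | ⟨_, _, h⟩
  · exact hu
  · exact h.2.1

lemma reflTransGen_adjAvoid_tail_iff_head {v u : V} {e : E} (ht : G.tail e ≠ v)
    (hh : G.head e ≠ v) :
    Relation.ReflTransGen (G.AdjAvoid v) u (G.tail e) ↔
      Relation.ReflTransGen (G.AdjAvoid v) u (G.head e) :=
  ⟨fun h => h.tail ⟨ht, hh, e, .inl ⟨rfl, rfl⟩⟩, fun h => h.tail ⟨hh, ht, e, .inr ⟨rfl, rfl⟩⟩⟩

variable [Group Γ]

lemma GainWalk.mono {F F' : Set E} (h : F ⊆ F') {u w : V} {g : Γ} (hw : G.GainWalk F u w g) :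
    G.GainWalk F' u w g := by
  induction hw with
  | nil => exact .nil
  | fwd _ he ht ih => exact .fwd ih (h he) ht
  | bwd _ he ht ih => exact .bwd ih (h he) ht

lemma GainWalk.trans {F : Set E} {u w x : V} {g g' : Γ} (h : G.GainWalk F u w g)
    (h' : G.GainWalk F w x g') : G.GainWalk F u x (g * g') := by
  induction h' with
  | nil => simpa using h
  | fwd _ he ht ih => rw [← mul_assoc]; exact .fwd ih he ht
  | bwd _ he ht ih => rw [← mul_assoc]; exact .bwd ih he ht

lemma GainWalk.of_edge {F : Set E} {e : E} (he : e ∈ F) :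
    G.GainWalk F (G.tail e) (G.head e) (G.gain e) := by
  simpa using GainWalk.fwd (G := G) .nil he rfl

lemma GainWalk.of_edge_inv {F : Set E} {e : E} (he : e ∈ F) :
    G.GainWalk F (G.head e) (G.tail e) (G.gain e)⁻¹ := by
  simpa using GainWalk.bwd (G := G) .nil he rfl

lemma GainWalk.symm {F : Set E} {u w : V} {g : Γ} (h : G.GainWalk F u w g) :
    G.GainWalk F w u g⁻¹ := by
  induction h with
  | nil => simpa using GainWalk.nil (G := G)
  | fwd _ he ht ih =>
    subst ht
    rw [mul_inv_rev]
    exact (GainWalk.of_edge_inv he).trans ih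
  | bwd _ he ht ih =>
    subst ht
    rw [mul_inv_rev, inv_inv]
    exact (GainWalk.of_edge he).trans ih

/-- Walks of `G` lift along a vertex map that is compatible with the ends of the edges. -/
lemma GainWalk.map {V' : Type*} {G' : GainGraph V' E Γ} {F : Set E} (φ : V → V')
    (ht : ∀ e ∈ F, G'.tail e = φ (G.tail e)) (hh : ∀ e ∈ F, G'.head e = φ (G.head e))
    (hg : ∀ e ∈ F, G'.gain e = G.gain e) {u w : V} {g : Γ} (h : G.GainWalk F u w g) :
    G'.GainWalk F (φ u) (φ w) g := by
  induction h with
  | nil => exact .nil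
  | fwd _ he he' ih =>
    rw [← hh _ he, ← hg _ he]
    exact .fwd ih he (by rw [ht _ he, he'])
  | bwd _ he he' ih =>
    rw [← ht _ he, ← hg _ he]
    exact .bwd ih he (by rw [hh _ he, he'])

lemma Balanced.mono {F F' : Set E} (h : F ⊆ F') (hF : G.Balanced F') : G.Balanced F :=
  fun v g hw => hF v g (hw.mono h)

/-- If the edges of `F` at `v` all lie in one part of the bipartition and `F` contains no loop
at `v`, then balancedness of the split implies balancedness of `F`. -/
lemma balanced_of_split_one_sided {F B : Set E} {v : V} (hF : Balanced (G.split v B) F)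
    (hloop : ∀ e ∈ F, ¬ (G.tail e = v ∧ G.head e = v))
    (hside : (∀ e ∈ F, e ∈ G.nonloopAt v → e ∈ B) ∨ (∀ e ∈ F, e ∈ G.nonloopAt v → e ∉ B)) :
    G.Balanced F := by
  have aux : ∀ e ∈ F, (G.tail e = v ∨ G.head e = v) → e ∈ G.nonloopAt v := by
    intro e he hv
    refine ⟨hv, fun h => hloop e he ?_⟩
    rcases hv with hv | hv
    · exact ⟨hv, h ▸ hv⟩
    · exact ⟨h.trans hv, hv⟩
  intro x g hw
  rcases hside with hs | hs
  · refine hF _ g (GainWalk.map (G' := G.split v B)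
      (fun x => if x = v then Sum.inr () else Sum.inl x) ?_ ?_ (fun _ _ => rfl) hw)
    · intro e he
      by_cases h : G.tail e = v
      · have h' : G.head e ≠ v := fun h' => hloop e he ⟨h, h'⟩
        simp [split, h, h', hs e he (aux e he (.inl h))]
      · simp [split, h]
    · intro e he
      by_cases h : G.head e = v
      · have h' : G.tail e ≠ v := fun h' => hloop e he ⟨h', h⟩
        simp [split, h', h, hs e he (aux e he (.inr h))]
      · simp [split, h]
  · refine hF _ g (GainWalk.map (G' := G.split v B) Sum.inl ?_ ?_ (fun _ _ => rfl) hw)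
    · intro e he
      by_cases h : G.tail e = v
      · have h' : G.head e ≠ v := fun h' => hloop e he ⟨h, h'⟩
        simp [split, h, h', hs e he (aux e he (.inl h))]
      · simp [split, h]
    · intro e he
      by_cases h : G.head e = v
      · have h' : G.tail e ≠ v := fun h' => hloop e he ⟨h', h⟩
        simp [split, h', h, hs e he (aux e he (.inr h))]
      · simp [split, h]

lemma IsSplitBase.mono {F F' : Finset E} {v : V} {B : Set E} (h : F ⊆ F')
    (hb : G.IsSplitBase F' v B) : G.IsSplitBase F v B :=
  ⟨hb.1, hb.2.mono (Finset.coe_subset.2 h)⟩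

lemma alphaTilde_nonpos {α : Set Γ → ℤ} (hpoly : Polymatroidal α) (hnorm : Normalized α)
    {F : Finset E} (hF : G.Balanced (F : Set E)) : alphaTilde α G F ≤ 0 := by
  unfold alphaTilde
  split_ifs with h
  · rw [← hnorm.2]
    exact hpoly.mono _ _ fun g hg => hF _ g hg
  · exact le_rfl

lemma beta_nonpos {α : Set Γ → ℤ} (hpoly : Polymatroidal α) (hnorm : Normalized α) (k : ℤ)
    [DecidableEq V] {F : Finset E} (hF : G.Balanced (F : Set E)) : beta α k G F ≤ 0 := by
  have := alphaTilde_nonpos hpoly hnorm hF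
  rw [beta, if_neg fun h => h.1 hF]
  exact this

lemma beta_le_of_isSplitBase {α : Set Γ → ℤ} (hpoly : Polymatroidal α) (hnorm : Normalized α)
    {k : ℤ} (hk : 0 ≤ k) [DecidableEq V] {F : Finset E} {v : V} {B : Set E}
    (hB : G.IsSplitBase F v B) : beta α k G F ≤ k := by
  by_cases hF : G.Balanced (F : Set E)
  · exact (beta_nonpos hpoly hnorm k hF).trans hk
  · rw [beta, if_pos ⟨hF, v, B, hB⟩]
    exact min_le_right _ _

lemma connected_of_root [DecidableEq V] {F : Finset E} (hF : F.Nonempty) (v : V)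
    (h : ∀ w ∈ G.verts F, ∃ g, G.GainWalk (F : Set E) v w g) : G.Connected F := by
  refine ⟨hF, fun u hu w hw => ?_⟩
  obtain ⟨g, hg⟩ := h u hu
  obtain ⟨g', hg'⟩ := h w hw
  exact ⟨_, hg.symm.trans hg'⟩

/-- Reachability in `G - v` is realised by walks using only edges that avoid `v`. -/
lemma exists_gainWalk_of_reflTransGen_adjAvoid {v u w : V}
    (h : Relation.ReflTransGen (G.AdjAvoid v) u w) :
    ∃ g, G.GainWalk {e | G.tail e ≠ v ∧ G.head e ≠ v} u w g := by
  induction h with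
  | refl => exact ⟨1, .nil⟩
  | tail _ h ih =>
    obtain ⟨g, hg⟩ := ih
    obtain ⟨h₁, h₂, e, ⟨rfl, rfl⟩ | ⟨rfl, rfl⟩⟩ := h
    · exact ⟨_, .fwd hg ⟨h₁, h₂⟩ rfl⟩
    · exact ⟨_, .bwd hg ⟨h₂, h₁⟩ rfl⟩

/-- Under the fullness hypothesis, no fraction of a base is balanced. -/
lemma not_balanced_of_isFraction [Fintype V] [DecidableEq V] [Fintype E]
    {k ℓ : ℤ} (hk : 1 ≤ k) (hl : ℓ ≤ 2 * k - 1) {α : Set Γ → ℤ} (hpoly : Polymatroidal α)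
    (hnorm : Normalized α) (hfull : FullGraph α k ℓ G)
    (hbeta : 2 * k - ℓ + 1 ≤ beta α k G (Finset.univ : Finset E)) {v : V} {B : Set E}
    (hB : G.IsSplitBase Finset.univ v B) {S : Finset E} (hS : G.IsFraction v S) :
    ¬ G.Balanced (S : Set E) := by
  intro hbal
  obtain ⟨u, hu, hS⟩ := hS
  obtain ⟨E', hE'conn, hspan, hsparse, hbeq, hcard⟩ := hfull
  set P : V → Prop := Relation.ReflTransGen (G.AdjAvoid v) u with hP
  have hPv : ¬ P v := fun h => ne_of_reflTransGen_adjAvoid hu h rfl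
  have hPedge : ∀ e, G.tail e ≠ v → G.head e ≠ v → (P (G.tail e) ↔ P (G.head e)) :=
    fun e => reflTransGen_adjAvoid_tail_iff_head
  have hPu : P u := .refl
  have memS : ∀ e, e ∈ S ↔ ¬ (G.tail e = v ∧ G.head e = v) ∧
      (G.tail e = v ∨ P (G.tail e)) ∧ (G.head e = v ∨ P (G.head e)) := by
    intro e; rw [hS]; simp
  clear_value P
  have hreach : ∀ w g, G.GainWalk (E' : Set E) v w g →
      (P w → ∃ g, G.GainWalk ((E' ∩ S : Finset E) : Set E) v w g) ∧
      (¬ P w → ∃ g, G.GainWalk ((E' \ S : Finset E) : Set E) v w g) := by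
    intro w g hw
    induction hw with
    | nil => exact ⟨fun h => absurd h hPv, fun _ => ⟨1, .nil⟩⟩
    | @fwd w g e _ he ht ih =>
      subst ht
      by_cases heS : e ∈ S
      · have hm : e ∈ ((E' ∩ S : Finset E) : Set E) := by simpa using ⟨he, heS⟩
        refine ⟨fun hp => ?_, fun hp => ?_⟩
        · rcases ((memS e).1 heS).2.1 with h | h
          · rw [← h]
            exact ⟨_, .of_edge hm⟩
          · obtain ⟨g, hg⟩ := ih.1 h
            exact ⟨_, .fwd hg hm rfl⟩
        · rw [((memS e).1 heS).2.2.resolve_right hp]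
          exact ⟨1, .nil⟩
      · have hm : e ∈ ((E' \ S : Finset E) : Set E) := by simpa using ⟨he, heS⟩
        have h1 := hPedge e
        have h2 := memS e
        refine ⟨fun hp => absurd hp (by grind), fun hp => ?_⟩
        obtain ⟨g, hg⟩ := ih.2 (by grind)
        exact ⟨_, .fwd hg hm rfl⟩
    | @bwd w g e _ he ht ih =>
      subst ht
      by_cases heS : e ∈ S
      · have hm : e ∈ ((E' ∩ S : Finset E) : Set E) := by simpa using ⟨he, heS⟩
        refine ⟨fun hp => ?_, fun hp => ?_⟩
        · rcases ((memS e).1 heS).2.2 with h | h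
          · rw [← h]
            exact ⟨_, .of_edge_inv hm⟩
          · obtain ⟨g, hg⟩ := ih.1 h
            exact ⟨_, .bwd hg hm rfl⟩
        · rw [((memS e).1 heS).2.1.resolve_right hp]
          exact ⟨1, .nil⟩
      · have hm : e ∈ ((E' \ S : Finset E) : Set E) := by simpa using ⟨he, heS⟩
        have h1 := hPedge e
        have h2 := memS e
        refine ⟨fun hp => absurd hp (by grind), fun hp => ?_⟩
        obtain ⟨g, hg⟩ := ih.2 (by grind)
        exact ⟨_, .bwd hg hm rfl⟩
  have hwalk : ∀ w, ∃ g, G.GainWalk (E' : Set E) v w g := fun w =>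
    hE'conn.2 v (by simp [hspan]) w (by simp [hspan])
  have hin : ∀ w ∈ G.verts (E' ∩ S), w = v ∨ P w := by
    intro w hw
    obtain ⟨e, he, rfl | rfl⟩ := mem_verts.1 hw
    · exact ((memS e).1 (Finset.mem_inter.1 he).2).2.1
    · exact ((memS e).1 (Finset.mem_inter.1 he).2).2.2
  have hout : ∀ w ∈ G.verts (E' \ S), ¬ P w := by
    intro w hw
    obtain ⟨e, he, h⟩ := mem_verts.1 hw
    have h1 := hPedge e
    have h2 := memS e
    have h3 := (Finset.mem_sdiff.1 he).2
    rcases h with rfl | rfl <;> grind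
  have hne₁ : (E' ∩ S).Nonempty := by
    have : u ∈ G.verts E' := by simp [hspan]
    obtain ⟨e, he, h⟩ := mem_verts.1 this
    have h1 := hPedge e
    have h2 := memS e
    refine ⟨e, Finset.mem_inter.2 ⟨he, ?_⟩⟩
    rcases h with rfl | rfl <;> grind
  have hne₂ : (E' \ S).Nonempty := by
    rw [Finset.sdiff_nonempty]
    intro hsub
    have := beta_nonpos hpoly hnorm k (hbal.mono (Finset.coe_subset.2 hsub))
    omega
  have hconn₁ : G.Connected (E' ∩ S) := connected_of_root hne₁ v fun w hw => by
    obtain ⟨g, hg⟩ := hwalk w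
    rcases hin w hw with rfl | h
    · exact ⟨1, .nil⟩
    · exact (hreach w g hg).1 h
  have hconn₂ : G.Connected (E' \ S) := connected_of_root hne₂ v fun w hw => by
    obtain ⟨g, hg⟩ := hwalk w
    exact (hreach w g hg).2 (hout w hw)
  have hs₁ := hsparse _ Finset.inter_subset_left hconn₁
  have hs₂ := hsparse _ Finset.sdiff_subset hconn₂
  have hb₁ : beta α k G (E' ∩ S) ≤ 0 :=
    beta_nonpos hpoly hnorm k (hbal.mono (Finset.coe_subset.2 Finset.inter_subset_right))
  have hb₂ : beta α k G (E' \ S) ≤ k :=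
    beta_le_of_isSplitBase hpoly hnorm (by omega) (hB.mono (Finset.subset_univ _))
  have hcE : ((E' ∩ S).card : ℤ) + ((E' \ S).card : ℤ) = E'.card := by
    exact_mod_cast Finset.card_inter_add_card_sdiff E' S
  have hcV : (G.verts (E' ∩ S)).card + (G.verts (E' \ S)).card ≤ Fintype.card V + 1 := by
    rw [← Finset.card_union_add_card_inter]
    refine add_le_add (Finset.card_le_univ _) ?_
    refine (Finset.card_le_card (t := {v}) fun w hw => ?_).trans (by simp)
    rw [Finset.mem_inter] at hw
    exact Finset.mem_singleton.2 ((hin w hw.1).resolve_right (hout w hw.2))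
  have hcV' : k * ((G.verts (E' ∩ S)).card : ℤ) + k * ((G.verts (E' \ S)).card : ℤ)
      ≤ k * (Fintype.card V : ℤ) + k := by
    have := mul_le_mul_of_nonneg_left (show ((G.verts (E' ∩ S)).card : ℤ) +
      ((G.verts (E' \ S)).card : ℤ) ≤ Fintype.card V + 1 by exact_mod_cast hcV)
      (show (0 : ℤ) ≤ k by omega)
    linarith
  rw [hspan, hbeq, min_eq_right hbeta, Finset.card_univ] at hcard
  unfold fAlpha at hs₁ hs₂
  linarith

/-- If every fraction of `v` is unbalanced, then every vertex is joined to `v` by a walk that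
avoids a given extra edge set with base `v`. -/
lemma exists_gainWalk_avoiding_extraEdgeSet [Fintype E] {v : V}
    (hfrac : ∀ S : Finset E, G.IsFraction v S → ¬ G.Balanced (S : Set E)) {K : Set E}
    (hK : G.ExtraEdgeSet Finset.univ v K) (w : V) :
    ∃ g, G.GainWalk {e | e ∉ K} v w g := by
  by_cases hw : w = v
  · subst hw
    exact ⟨1, .nil⟩
  obtain ⟨S, hS⟩ : ∃ S, S = Finset.univ.filter (fun e =>
      ¬ (G.tail e = v ∧ G.head e = v) ∧
      (G.tail e = v ∨ Relation.ReflTransGen (G.AdjAvoid v) w (G.tail e)) ∧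
      (G.head e = v ∨ Relation.ReflTransGen (G.AdjAvoid v) w (G.head e))) := ⟨_, rfl⟩
  have memS : ∀ e ∈ S, ¬ (G.tail e = v ∧ G.head e = v) ∧
      (G.tail e = v ∨ Relation.ReflTransGen (G.AdjAvoid v) w (G.tail e)) ∧
      (G.head e = v ∨ Relation.ReflTransGen (G.AdjAvoid v) w (G.head e)) := by
    intro e he
    rw [hS] at he
    simpa using he
  have hunbal := hfrac S ⟨w, hw, hS⟩
  obtain ⟨B, hB, hK⟩ := hK
  have hBS := hB.mono (Finset.subset_univ S)
  obtain ⟨e, heS, hev, heK⟩ : ∃ e ∈ S, e ∈ G.nonloopAt v ∧ e ∉ K := by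
    by_contra! hcon
    refine hunbal (balanced_of_split_one_sided hBS.2 (fun e he => (memS e he).1) ?_)
    have hul : ∀ e ∈ S, e ∉ G.unbalancedLoopsAt v := fun e he h =>
      (memS e he).1 ⟨h.1, h.2.1⟩
    rcases hK with rfl | rfl
    · exact .inl fun e he hev => (hcon e he hev).resolve_right (hul e he)
    · exact .inr fun e he hev => ((hcon e he hev).resolve_right (hul e he)).2
  have havoid : {e | G.tail e ≠ v ∧ G.head e ≠ v} ⊆ {e | e ∉ K} := by
    intro e he heK
    have hinc : G.tail e = v ∨ G.head e = v := by
      rcases hK with rfl | rfl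
      · rcases heK with h | h
        · exact (hB.1 h).1
        · exact .inl h.1
      · rcases heK with h | h
        · exact h.1.1
        · exact .inl h.1
    exact hinc.elim he.1 he.2
  have hm := memS e heS
  rcases hev.1 with h | h
  · obtain ⟨g, hg⟩ := exists_gainWalk_of_reflTransGen_adjAvoid
      (hm.2.2.resolve_left fun h' => hm.1 ⟨h, h'⟩)
    have he := GainWalk.of_edge (G := G) (F := {e | e ∉ K}) heK
    rw [h] at he
    exact ⟨_, he.trans (hg.mono havoid).symm⟩
  · obtain ⟨g, hg⟩ := exists_gainWalk_of_reflTransGen_adjAvoid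
      (hm.2.1.resolve_left fun h' => hm.1 ⟨h', h⟩)
    have he := GainWalk.of_edge_inv (G := G) (F := {e | e ∉ K}) heK
    rw [h] at he
    exact ⟨_, he.trans (hg.mono havoid).symm⟩

end

end GainGraph

/-- Lemma 3: if `(G,ψ)` is near-balanced and `f_α`-full with
`β(E(G)) ≥ 2k - ℓ + 1` and `v` is a base for the near-balancedness, then each fraction of
`v` is near-balanced; in particular, for each extra edge set `K` of the near-balancedness,
`G - K` is connected. -/
theorem statement11 {V E Γ : Type} [Fintype V] [DecidableEq V] [Fintype E] [DecidableEq E]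
    [Group Γ] (k ℓ : ℤ) (hk : 1 ≤ k) (hl0 : 0 ≤ ℓ) (hl : ℓ ≤ 2 * k - 1)
    (α : Set Γ → ℤ) (hpoly : Polymatroidal α) (hnorm : Normalized α)
    (hrange : ∀ X : Set Γ, 0 ≤ α X ∧ α X ≤ ℓ) (hsmooth : Smooth α k)
    (G : GainGraph V E Γ)
    (hconn : G.Connected (Finset.univ : Finset E))
    (hnb : G.NearBalanced (Finset.univ : Finset E))
    (hfull : GainGraph.FullGraph α k ℓ G)
    (hbeta : 2 * k - ℓ + 1 ≤ GainGraph.beta α k G (Finset.univ : Finset E))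
    (v : V) (hbase : ∃ B : Set E, G.IsSplitBase Finset.univ v B) :
    (∀ S : Finset E, G.IsFraction v S → G.NearBalanced S) ∧
    ∀ K : Set E, G.ExtraEdgeSet Finset.univ v K →
      ∀ u w : V, ∃ g : Γ, G.GainWalk {e : E | e ∉ K} u w g := by
  obtain ⟨B, hB⟩ := hbase
  have hfrac : ∀ S : Finset E, G.IsFraction v S → ¬ G.Balanced (S : Set E) := fun S hS =>
    GainGraph.not_balanced_of_isFraction hk hl hpoly hnorm hfull hbeta hB hS
  refine ⟨fun S hS => ⟨hfrac S hS, v, B, hB.mono (Finset.subset_univ S)⟩, fun K hK u w => ?_⟩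
  obtain ⟨g, hg⟩ := GainGraph.exists_gainWalk_avoiding_extraEdgeSet hfrac hK u
  obtain ⟨g', hg'⟩ := GainGraph.exists_gainWalk_avoiding_extraEdgeSet hfrac hK w
  exact ⟨_, hg.symm.trans hg'⟩

end CountMatroidPaper
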